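/- arXiv:1701.07130 — 3 statements merged into one kernel-verified Lean document; each statement's English description precedes it below -/
import Mathlib

section
/- Let I ⊆ S be a fixed proper monomial ideal all of whose minimal monomial generators have degree at most D, and let 𝔍 be the random monomial ideal of the ER-type model with parameter p ∈ (0,1). Then P(𝔍 = I) = p^{β₁(S/I)} · (1−p)^{N}, where N = Σ_{d=1}^{D} h_I(d) is the number of nonconstant monomials of degree at most D not contained in I. -/
open Finset MvPolynomial Filter

noncomputable section

/-- The set of exponent vectors of nonconstant monomials in `n` variables of total degree
at most `D`. -/
def monSet (n D : ℕ) : Finset (Fin n → ℕ) :=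
  (Fintype.piFinset fun _ : Fin n => Finset.range (D + 1)).filter
    fun α => 0 < ∑ i, α i ∧ ∑ i, α i ≤ D

/-- The monomial `x^α` of `MvPolynomial (Fin n) K` with exponent vector `α`. -/
def mono (K : Type*) [CommRing K] {n : ℕ} (α : Fin n → ℕ) : MvPolynomial (Fin n) K :=
  MvPolynomial.monomial (Finsupp.equivFunOnFinite.symm α) 1

/-- The monomial ideal generated by a set of exponent vectors. -/
def idealOf (K : Type*) [CommRing K] {n : ℕ} (B : Finset (Fin n → ℕ)) :
    Ideal (MvPolynomial (Fin n) K) :=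
  Ideal.span (mono K '' (B : Set (Fin n → ℕ)))

open Classical in
/-- The probability, under the ER-type model `ℐ(n,D,p)`, of the event `E` on random
generating sets `𝔅 ⊆ M(n,D)`. -/
def ERprob (n D : ℕ) (p : ℝ) (E : Set (Finset (Fin n → ℕ))) : ℝ :=
  ∑ B ∈ (monSet n D).powerset.filter (· ∈ E),
    p ^ B.card * (1 - p) ^ ((monSet n D).card - B.card)

/-- `I` is a monomial ideal. -/
def IsMonomialIdeal (K : Type*) [CommRing K] {n : ℕ}
    (I : Ideal (MvPolynomial (Fin n) K)) : Prop :=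
  ∃ G : Set (Fin n → ℕ), I = Ideal.span (mono K '' G)

/-- `x^α` is a minimal monomial generator of `I`: it lies in `I` and no proper divisor does. -/
def IsMinGen (K : Type*) [CommRing K] {n : ℕ} (I : Ideal (MvPolynomial (Fin n) K))
    (α : Fin n → ℕ) : Prop :=
  mono K α ∈ I ∧ ∀ β : Fin n → ℕ, (∀ i, β i ≤ α i) → β ≠ α → mono K β ∉ I

/-- `β₁(S/I)`: the number of minimal monomial generators of `I`. -/
def beta1 (K : Type*) [CommRing K] {n : ℕ} (I : Ideal (MvPolynomial (Fin n) K)) : ℕ :=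
  {α : Fin n → ℕ | IsMinGen K I α}.ncard

/-- `β_{1,d}(S/I)`: the number of minimal monomial generators of `I` of degree `d`. -/
def beta1d (K : Type*) [CommRing K] {n : ℕ} (I : Ideal (MvPolynomial (Fin n) K)) (d : ℕ) : ℕ :=
  {α : Fin n → ℕ | IsMinGen K I α ∧ ∑ i, α i = d}.ncard

/-- `h_I(d)`: the number of monomials of degree exactly `d` not contained in `I`. -/
def hilb (K : Type*) [CommRing K] {n : ℕ} (I : Ideal (MvPolynomial (Fin n) K)) (d : ℕ) : ℕ :=
  {α : Fin n → ℕ | ∑ i, α i = d ∧ mono K α ∉ I}.ncard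

theorem mono_mem_span_iff (K : Type*) [Field K] {n : ℕ} (S : Set (Fin n → ℕ)) (α : Fin n → ℕ) :
    mono K α ∈ Ideal.span (mono K '' S) ↔ ∃ s ∈ S, s ≤ α := by
  classical
  have h : mono K '' S = (fun s => MvPolynomial.monomial s (1 : K)) ''
      (Finsupp.equivFunOnFinite.symm '' S) := by
    rw [Set.image_image]; rfl
  rw [h, MvPolynomial.mem_ideal_span_monomial_image, mono,
    MvPolynomial.support_monomial, if_neg one_ne_zero]
  simp only [Finset.mem_singleton, forall_eq, Set.exists_mem_image]
  rfl

theorem isMinGen_iff_minimal (K : Type*) [Field K] {n : ℕ} (I : Ideal (MvPolynomial (Fin n) K))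
    (α : Fin n → ℕ) : IsMinGen K I α ↔ Minimal (fun β => mono K β ∈ I) α := by
  rw [minimal_iff]
  refine and_congr_right fun _ => ⟨fun h β hβ hle => ?_, fun h β hle hne hβ => ?_⟩
  · by_contra hne
    exact h β hle (Ne.symm hne) hβ
  · exact hne (h hβ hle).symm

theorem exists_isMinGen_le (K : Type*) [Field K] {n : ℕ} (I : Ideal (MvPolynomial (Fin n) K))
    {α : Fin n → ℕ} (hα : mono K α ∈ I) : ∃ β ≤ α, IsMinGen K I β := by
  obtain ⟨β, hle, hβ⟩ := exists_minimal_le_of_wellFoundedLT (fun β => mono K β ∈ I) α hα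
  exact ⟨β, hle, (isMinGen_iff_minimal K I β).2 hβ⟩

theorem mem_monSet {n D : ℕ} {α : Fin n → ℕ} :
    α ∈ monSet n D ↔ 0 < ∑ i, α i ∧ ∑ i, α i ≤ D := by
  simp only [monSet, Finset.mem_filter, Fintype.mem_piFinset, Finset.mem_range,
    and_iff_right_iff_imp]
  rintro ⟨-, h⟩ i
  exact Nat.lt_succ_of_le
    ((Finset.single_le_sum (fun j _ => Nat.zero_le (α j)) (Finset.mem_univ i)).trans h)

theorem IsMinGen.sum_pos {K : Type*} [Field K] {n : ℕ} {I : Ideal (MvPolynomial (Fin n) K)}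
    (hI : I ≠ ⊤) {α : Fin n → ℕ} (hα : IsMinGen K I α) : 0 < ∑ i, α i := by
  refine Nat.pos_of_ne_zero fun h => hI ((Ideal.eq_top_iff_one I).2 ?_)
  have h0 : α = 0 := funext fun i => Finset.sum_eq_zero_iff.1 h i (Finset.mem_univ i)
  have h1 : mono K α = 1 := by
    have : Finsupp.equivFunOnFinite.symm α = 0 := by ext i; simp [h0]
    rw [mono, this]; rfl
  exact h1 ▸ hα.1

theorem idealOf_eq_iff {K : Type*} [Field K] {n : ℕ} {I : Ideal (MvPolynomial (Fin n) K)}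
    (hI : IsMonomialIdeal K I) (B : Finset (Fin n → ℕ)) :
    idealOf K B = I ↔ (∀ α, IsMinGen K I α → α ∈ B) ∧ ∀ α ∈ B, mono K α ∈ I := by
  constructor
  · rintro rfl
    have hB : ∀ α ∈ B, mono K α ∈ idealOf K B := fun α hα =>
      Ideal.subset_span (Set.mem_image_of_mem _ hα)
    refine ⟨fun α hα => ?_, hB⟩
    obtain ⟨s, hs, hle⟩ := (mono_mem_span_iff K _ α).1 hα.1
    by_contra hn
    exact hα.2 s hle (fun h => hn (h ▸ hs)) (hB s hs)
  · rintro ⟨hG, hB⟩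
    refine le_antisymm (Ideal.span_le.2 (Set.image_subset_iff.2 hB)) ?_
    obtain ⟨S, hS⟩ := hI
    conv_lhs => rw [hS]
    refine Ideal.span_le.2 (Set.image_subset_iff.2 fun s hs => ?_)
    have hsI : mono K s ∈ I := hS ▸ Ideal.subset_span (Set.mem_image_of_mem _ hs)
    obtain ⟨β, hle, hβ⟩ := exists_isMinGen_le K I hsI
    exact (mono_mem_span_iff K _ s).2 ⟨β, hG β hβ, hle⟩

/-- The total mass of an interval of subsets `G ⊆ B ⊆ A` under the product Bernoulli measure
on the subsets of `M`. -/
theorem sum_Icc_pow_card_mul {ι : Type*} [DecidableEq ι] {G A M : Finset ι} (hGA : G ⊆ A)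
    (hAM : A ⊆ M) (p : ℝ) :
    ∑ B ∈ Finset.Icc G A, p ^ B.card * (1 - p) ^ (M.card - B.card) =
      p ^ G.card * (1 - p) ^ (M \ A).card := by
  have hdisj : ∀ C ∈ (A \ G).powerset, Disjoint G C := fun C hC =>
    Finset.disjoint_sdiff.mono_right (Finset.mem_powerset.1 hC)
  rw [Finset.Icc_eq_image_powerset hGA, Finset.sum_image]
  · have hterm : ∀ C ∈ (A \ G).powerset,
        p ^ (G ∪ C).card * (1 - p) ^ (M.card - (G ∪ C).card) =
          (p ^ G.card * (1 - p) ^ (M \ A).card) *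
            (p ^ C.card * (1 - p) ^ ((A \ G).card - C.card)) := by
      intro C hC
      have h1 := Finset.card_union_of_disjoint (hdisj C hC)
      have h2 := Finset.card_le_card (Finset.mem_powerset.1 hC)
      have h3 := Finset.card_sdiff_add_card_eq_card hGA
      have h4 := Finset.card_sdiff_add_card_eq_card hAM
      have h5 : M.card - (G ∪ C).card = (M \ A).card + ((A \ G).card - C.card) := by omega
      rw [h5, h1, pow_add, pow_add]
      ring
    rw [Finset.sum_congr rfl hterm, ← Finset.mul_sum, Finset.sum_pow_mul_eq_add_pow]
    simp
  · intro C hC C' hC' h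
    have h' : G ∪ C = G ∪ C' := h
    rw [← Finset.union_sdiff_cancel_left (hdisj C hC), h',
      Finset.union_sdiff_cancel_left (hdisj C' hC')]

theorem sum_hilb_eq_card (K : Type*) [Field K] {n D : ℕ} (I : Ideal (MvPolynomial (Fin n) K))
    (N : Finset (Fin n → ℕ)) (hN : ∀ α, α ∈ N ↔ α ∈ monSet n D ∧ mono K α ∉ I) :
    ∑ d ∈ Finset.Icc 1 D, hilb K I d = N.card := by
  rw [Finset.card_eq_sum_card_fiberwise (f := fun α : Fin n → ℕ => ∑ i, α i)
    (t := Finset.Icc 1 D) fun α hα => Finset.mem_coe.2 (Finset.mem_Icc.2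
      (mem_monSet.1 ((hN α).1 hα).1))]
  refine Finset.sum_congr rfl fun d hd => ?_
  rw [hilb, ← Set.ncard_coe_finset]
  congr 1
  ext α
  have := Finset.mem_Icc.1 hd
  simp only [Set.mem_ofPred_eq, Finset.coe_filter, hN, mem_monSet]
  constructor
  · rintro ⟨rfl, h⟩
    exact ⟨⟨⟨this.1, this.2⟩, h⟩, rfl⟩
  · rintro ⟨⟨-, h⟩, rfl⟩
    exact ⟨rfl, h⟩

/-- Theorem 1.1. For a fixed proper monomial ideal `I` all of whose minimal
generators have degree at most `D`, under the ER-type model with parameter `p ∈ (0,1)`,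
`P(𝔍 = I) = p^{β₁(S/I)} (1-p)^{Σ_{d=1}^D h_I(d)}`. -/
theorem stmt0 (K : Type*) [Field K] (n D : ℕ) (hn : 1 ≤ n) (hD : 1 ≤ D)
    (p : ℝ) (hp0 : 0 < p) (hp1 : p < 1)
    (I : Ideal (MvPolynomial (Fin n) K)) (hmon : IsMonomialIdeal K I) (hproper : I ≠ ⊤)
    (hdeg : ∀ α : Fin n → ℕ, IsMinGen K I α → ∑ i, α i ≤ D) :
    ERprob n D p {B | idealOf K B = I} =
      p ^ beta1 K I * (1 - p) ^ (∑ d ∈ Finset.Icc 1 D, hilb K I d) := by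
  classical
  set M := monSet n D with hM
  set A := M.filter (fun α => mono K α ∈ I) with hA
  set G := M.filter (fun α => IsMinGen K I α) with hG
  have hminM : ∀ α, IsMinGen K I α → α ∈ M := fun α hα =>
    mem_monSet.2 ⟨hα.sum_pos hproper, hdeg α hα⟩
  have hGA : G ⊆ A := Finset.monotone_filter_right _ fun α _ hα => hα.1
  have hbeta : beta1 K I = G.card := by
    rw [beta1, ← Set.ncard_coe_finset]
    congr 1
    ext α
    simpa [hG] using hminM α
  have hsum : ∑ d ∈ Finset.Icc 1 D, hilb K I d = (M \ A).card :=
    sum_hilb_eq_card K I _ fun α => by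
      simp only [hA, Finset.mem_sdiff, Finset.mem_filter, hM]
      tauto
  rw [hbeta, hsum, ← sum_Icc_pow_card_mul hGA (Finset.filter_subset _ _) p, ERprob]
  refine Finset.sum_congr ?_ fun _ _ => rfl
  ext B
  simp only [Finset.mem_filter, Finset.mem_powerset, Set.mem_ofPred_eq, Finset.mem_Icc,
    idealOf_eq_iff hmon]
  constructor
  · rintro ⟨hBM, hGB, hBI⟩
    exact ⟨fun α hα => hGB α (Finset.mem_filter.1 hα).2,
      fun α hα => Finset.mem_filter.2 ⟨hBM hα, hBI α hα⟩⟩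
  · rintro ⟨hGB, hBA⟩
    exact ⟨hBA.trans (Finset.filter_subset _ _),
      fun α hα => hGB (Finset.mem_filter.2 ⟨hminM α hα, hα⟩),
      fun α hα => (Finset.mem_filter.1 (hBA hα)).2⟩

end
end

section
/- Let 𝔍 be the random monomial ideal of the ER-type model with parameter p ∈ (0,1). Then the probability that the quotient ring S/𝔍 has Krull dimension 0 equals (1 − (1−p)^D)^n. -/
open Finset MvPolynomial Filter

noncomputable section

/-- If the sets `C i` are disjoint subsets of `M`, all of size `D`, a random subset of `M` meets
all of them with probability `(1 - (1 - p) ^ D) ^ |ι|`. -/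
lemma sum_powerset_weight_of_forall_inter_nonempty {ι α : Type*} [Fintype ι] [DecidableEq α]
    (M : Finset α) (C : ι → Finset α) (D : ℕ) (hC : ∀ i, C i ⊆ M) (hcard : ∀ i, #(C i) = D)
    (hdisj : Pairwise fun i j => Disjoint (C i) (C j)) (p : ℝ) :
    ∑ B ∈ M.powerset with ∀ i, ¬ Disjoint B (C i), p ^ #B * (1 - p) ^ (#M - #B) =
      (1 - (1 - p) ^ D) ^ Fintype.card ι := by
  classical
  have avoid (U : Finset α) (hU : U ⊆ M) :
      ∑ B ∈ M.powerset, p ^ #B * (1 - p) ^ (#M - #B) * (if Disjoint B U then 1 else 0) =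
        (1 - p) ^ #U := by
    have hset : M.powerset.filter (Disjoint · U) = (M \ U).powerset := by
      ext B
      simp [subset_sdiff]
    simp_rw [mul_ite, mul_one, mul_zero]
    rw [← sum_filter, hset]
    calc _ = ∑ B ∈ (M \ U).powerset, (1 - p) ^ #U * (p ^ #B * (1 - p) ^ (#(M \ U) - #B)) := by
          refine sum_congr rfl fun B hB => ?_
          have h1 := card_le_card (mem_powerset.1 hB)
          have h2 := card_sdiff_add_card_eq_card hU
          rw [show #M - #B = #U + (#(M \ U) - #B) by omega, pow_add]
          ring
      _ = _ := by rw [← mul_sum, sum_pow_mul_eq_add_pow]; simp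
  have indicator (B : Finset α) : (if ∀ i, ¬ Disjoint B (C i) then (1 : ℝ) else 0) =
      ∑ T : Finset ι, (-1) ^ #T * (if Disjoint B (T.biUnion C) then 1 else 0) := by
    calc _ = ∏ i, (1 + -(if Disjoint B (C i) then (1 : ℝ) else 0)) := by
          split_ifs with h
          · simp [h]
          · push Not at h
            obtain ⟨i, hi⟩ := h
            exact (prod_eq_zero (mem_univ i) (by simp [hi])).symm
      _ = _ := by
          rw [prod_one_add, powerset_univ]
          refine sum_congr rfl fun T _ => ?_
          rw [prod_neg, prod_ite_zero]
          simp [disjoint_biUnion_right]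
  calc _ = ∑ B ∈ M.powerset, p ^ #B * (1 - p) ^ (#M - #B) *
          (if ∀ i, ¬ Disjoint B (C i) then (1 : ℝ) else 0) := by simp [sum_filter]
    _ = ∑ T : Finset ι, (-1) ^ #T * ∑ B ∈ M.powerset, p ^ #B * (1 - p) ^ (#M - #B) *
          (if Disjoint B (T.biUnion C) then 1 else 0) := by
        simp_rw [indicator, mul_sum]
        rw [sum_comm]
        refine sum_congr rfl fun T _ => sum_congr rfl fun B _ => by ring
    _ = ∑ T : Finset ι, ∏ i ∈ T, -(1 - p) ^ D := by
        refine sum_congr rfl fun T _ => ?_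
        rw [avoid _ (biUnion_subset.2 fun i _ => hC i),
          card_biUnion fun i _ j _ hij => hdisj hij, prod_const,
          neg_pow ((1 - p) ^ D), ← pow_mul]
        simp [hcard, mul_comm]
    _ = _ := by
        rw [← powerset_univ, ← prod_one_add, prod_const, card_univ, ← sub_eq_add_neg]

lemma mono_eq_prod (K : Type*) [CommRing K] {n : ℕ} (α : Fin n → ℕ) :
    mono K α = ∏ i, X i ^ α i := by
  rw [mono, monomial_eq, map_one, one_mul, Finsupp.prod_fintype _ _ (by simp)]
  rfl

lemma mono_single (K : Type*) [CommRing K] {n : ℕ} (i : Fin n) (d : ℕ) :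
    mono K (Pi.single i d) = X i ^ d := by
  rw [mono_eq_prod, Fintype.prod_eq_single i fun j hj => by simp [hj], Pi.single_eq_same]

/-- A prime ideal containing a power of every variable is maximal. -/
lemma isMaximal_of_forall_X_mem {K σ : Type*} [Field K] (P : Ideal (MvPolynomial σ K))
    (hP : P ≠ ⊤) (hX : ∀ i, X i ∈ P) : P.IsMaximal := by
  have hmax : (RingHom.ker (constantCoeff : MvPolynomial σ K →+* K)).IsMaximal :=
    RingHom.ker_isMaximal_of_surjective _ fun a => ⟨C a, by simp⟩
  have hle : RingHom.ker (constantCoeff : MvPolynomial σ K →+* K) ≤ P := by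
    intro f hf
    have hmk : Ideal.Quotient.mk P = (Ideal.Quotient.mk P).comp (C.comp constantCoeff) := by
      ext i
      · simp
      · simpa using Ideal.Quotient.eq_zero_iff_mem.2 (hX i)
    rw [← Ideal.Quotient.eq_zero_iff_mem, hmk]
    simp [(RingHom.mem_ker).1 hf]
  exact hmax.eq_of_le hP hle ▸ hmax

lemma idealOf_ne_top (K : Type*) [Field K] {n : ℕ} (B : Finset (Fin n → ℕ))
    (hB : ∀ α ∈ B, α ≠ 0) : idealOf K B ≠ ⊤ := by
  have hle : idealOf K B ≤ RingHom.ker (constantCoeff : MvPolynomial (Fin n) K →+* K) := by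
    rw [idealOf, Ideal.span_le]
    rintro _ ⟨α, hα, rfl⟩
    obtain ⟨i, hi⟩ := Function.ne_iff.1 (hB α hα)
    rw [SetLike.mem_coe, RingHom.mem_ker, mono_eq_prod, map_prod]
    exact prod_eq_zero (mem_univ i) (by simpa using hi)
  exact ne_top_of_le_ne_top (RingHom.ker_ne_top _) hle

/-- A proper monomial ideal is zero-dimensional iff its generators include a pure power of every
variable. -/
lemma ringKrullDim_quotient_idealOf_eq_zero_iff (K : Type*) [Field K] {n : ℕ}
    (B : Finset (Fin n → ℕ)) (hB : ∀ α ∈ B, α ≠ 0) :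
    ringKrullDim (MvPolynomial (Fin n) K ⧸ idealOf K B) = 0 ↔
      ∀ i, ∃ d, Pi.single i d ∈ B := by
  have : Nontrivial (MvPolynomial (Fin n) K ⧸ idealOf K B) :=
    Ideal.Quotient.nontrivial_iff.2 (idealOf_ne_top K B hB)
  constructor
  · intro h i
    by_contra! hi
    let f : MvPolynomial (Fin n) K →ₐ[K] Polynomial K :=
      aeval (Pi.single i Polynomial.X)
    have hf : ∀ a ∈ idealOf K B, f.toRingHom a = 0 := by
      suffices idealOf K B ≤ RingHom.ker f.toRingHom from fun a ha => this ha
      rw [idealOf, Ideal.span_le]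
      rintro _ ⟨α, hα, rfl⟩
      obtain ⟨j, hji, hj⟩ : ∃ j, j ≠ i ∧ α j ≠ 0 := by
        by_contra! hj
        refine hi (α i) ?_
        suffices h_eq : Pi.single i (α i) = α by rwa [h_eq]
        ext j
        by_cases hji : j = i
        · subst hji; simp
        · simp [hji, hj j hji]
      rw [SetLike.mem_coe, RingHom.mem_ker, mono_eq_prod, map_prod]
      exact prod_eq_zero (mem_univ j) (by simp [f, hji, hj])
    have hsurj : Function.Surjective f := by
      intro g
      refine ⟨Polynomial.aeval (X i) g, ?_⟩
      rw [← Polynomial.aeval_algHom_apply]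
      simp [f]
    have hle := ringKrullDim_le_of_surjective (Ideal.Quotient.lift _ f.toRingHom hf)
      (Ideal.Quotient.lift_surjective_of_surjective _ hf hsurj)
    rw [h, IsPrincipalIdealRing.ringKrullDim_eq_one _ (Polynomial.not_isField K)] at hle
    exact absurd hle (by decide)
  · intro h
    rw [← ringKrullDimZero_iff_ringKrullDim_eq_zero,
      Ideal.krullDimLE_zero_quotient_iff_forall_minimalPrimes_isMaximal]
    intro P hP
    have hprime : P.IsPrime := hP.1.1
    refine isMaximal_of_forall_X_mem P hprime.ne_top fun i => ?_
    obtain ⟨d, hd⟩ := h i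
    refine hprime.mem_of_pow_mem d ?_
    rw [← mono_single]
    exact hP.1.2 (Ideal.subset_span ⟨_, hd, rfl⟩)

/-- The exponent vectors of the positive powers of `xᵢ` of degree at most `D`. -/
def purePowers {n : ℕ} (D : ℕ) (i : Fin n) : Finset (Fin n → ℕ) :=
  (Finset.Icc 1 D).map ⟨Pi.single i, Pi.single_injective i⟩

lemma mem_purePowers {n D : ℕ} {i : Fin n} {α : Fin n → ℕ} :
    α ∈ purePowers D i ↔ ∃ d, (1 ≤ d ∧ d ≤ D) ∧ Pi.single i d = α := by
  simp [purePowers]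

lemma single_mem_monSet_iff {n D : ℕ} (i : Fin n) (d : ℕ) :
    Pi.single i d ∈ monSet n D ↔ 1 ≤ d ∧ d ≤ D := by
  simp only [monSet, mem_filter, Fintype.mem_piFinset, Finset.mem_range, sum_pi_single',
    mem_univ, if_true]
  refine ⟨fun h => h.2, fun h => ⟨fun j => ?_, h⟩⟩
  by_cases hj : j = i
  · subst hj; simp; omega
  · simp [hj]

lemma ne_zero_of_mem_monSet {n D : ℕ} {α : Fin n → ℕ} (hα : α ∈ monSet n D) : α ≠ 0 := by
  rintro rfl
  simp [monSet] at hα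

lemma pairwise_disjoint_purePowers (n D : ℕ) :
    Pairwise fun i j : Fin n => Disjoint (purePowers D i) (purePowers D j) := by
  intro i j hij
  rw [Finset.disjoint_left]
  intro α hi hj
  obtain ⟨d, hd, rfl⟩ := mem_purePowers.1 hi
  obtain ⟨e, he, h⟩ := mem_purePowers.1 hj
  have := congrFun h i
  simp [hij] at this
  omega

/-- Theorem 3.2(a). Under the ER-type model,
`P(dim S/𝔍 = 0) = (1-(1-p)^D)^n`. -/
theorem stmt4 (K : Type*) [Field K] (n D : ℕ) (hn : 1 ≤ n) (hD : 1 ≤ D)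
    (p : ℝ) (hp0 : 0 < p) (hp1 : p < 1) :
    ERprob n D p {B | ringKrullDim (MvPolynomial (Fin n) K ⧸ idealOf K B)
        = (0 : WithBot (WithTop ℕ))} =
      (1 - (1 - p) ^ D) ^ n := by
  classical
  have hset : (monSet n D).powerset.filter (· ∈ {B | ringKrullDim
        (MvPolynomial (Fin n) K ⧸ idealOf K B) = (0 : WithBot (WithTop ℕ))}) =
      (monSet n D).powerset.filter fun B => ∀ i, ¬ Disjoint B (purePowers D i) := by
    refine filter_congr fun B hB => ?_
    rw [mem_powerset] at hB
    refine (ringKrullDim_quotient_idealOf_eq_zero_iff K B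
      fun α hα => ne_zero_of_mem_monSet (hB hα)).trans (forall_congr' fun i => ?_)
    rw [Finset.not_disjoint_iff]
    constructor
    · rintro ⟨d, hd⟩
      exact ⟨_, hd, mem_purePowers.2 ⟨d, (single_mem_monSet_iff i d).1 (hB hd), rfl⟩⟩
    · rintro ⟨α, hα, hi⟩
      obtain ⟨d, -, rfl⟩ := mem_purePowers.1 hi
      exact ⟨d, hα⟩
  have hsum := sum_powerset_weight_of_forall_inter_nonempty (monSet n D) (purePowers D) D
    (fun i α hα => by
      obtain ⟨d, hd, rfl⟩ := mem_purePowers.1 hα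
      exact (single_mem_monSet_iff i d).2 hd)
    (fun i => by simp [purePowers]) (pairwise_disjoint_purePowers n D) p
  rw [Fintype.card_fin] at hsum
  rw [← hsum, ERprob]
  refine sum_congr ?_ fun _ _ => rfl
  convert hset

end
end

section
/- Let n and t be fixed integers with 0 ≤ t ≤ n−1, and let p : ℕ → (0,1) satisfy D^t · p(D) → 0 as D → ∞. Then the probability, under the ER-type model with parameter p(D), that the random generating set 𝔅 contains a monomial whose support has size at most t tends to 0 as D → ∞. -/
open Finset MvPolynomial Filter

noncomputable section

/-- A Bernoulli random subset of `s` contains a given `a ∈ s` with probability `p`. -/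
lemma sum_powerset_filter_mem_bernoulli {ι : Type*} [DecidableEq ι] (s : Finset ι) (p : ℝ)
    {a : ι} (ha : a ∈ s) :
    ∑ B ∈ s.powerset with a ∈ B, p ^ B.card * (1 - p) ^ (s.card - B.card) = p := by
  obtain ⟨s, has, rfl⟩ : ∃ s', a ∉ s' ∧ insert a s' = s :=
    ⟨s.erase a, Finset.notMem_erase a s, Finset.insert_erase ha⟩
  rw [Finset.sum_filter, Finset.sum_powerset_insert has]
  have h_without : ∑ B ∈ s.powerset, (if a ∈ B then
      p ^ B.card * (1 - p) ^ ((insert a s).card - B.card) else 0) = 0 :=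
    Finset.sum_eq_zero fun B hB =>
      if_neg fun h => has (Finset.mem_powerset.1 hB h)
  have h_with : ∀ B ∈ s.powerset, (if a ∈ insert a B then
      p ^ (insert a B).card * (1 - p) ^ ((insert a s).card - (insert a B).card) else 0)
      = p * (p ^ B.card * (1 - p) ^ (s.card - B.card)) := by
    intro B hB
    have haB : a ∉ B := fun h => has (Finset.mem_powerset.1 hB h)
    rw [if_pos (Finset.mem_insert_self a B), Finset.card_insert_of_notMem haB,
      Finset.card_insert_of_notMem has, Nat.add_sub_add_right, pow_succ]
    ring
  rw [h_without, Finset.sum_congr rfl h_with, ← Finset.mul_sum, Finset.sum_pow_mul_eq_add_pow]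
  simp

/-- The sum of a nonnegative function over a union is at most the sum of its sums. -/
lemma sum_biUnion_le_sum_sum {ι κ : Type*} [DecidableEq κ] (s : Finset ι) (u : ι → Finset κ)
    {w : κ → ℝ} (hw : ∀ x, 0 ≤ w x) :
    ∑ x ∈ s.biUnion u, w x ≤ ∑ i ∈ s, ∑ x ∈ u i, w x := by
  classical
  induction s using Finset.induction_on with
  | empty => simp
  | insert a s ha ih =>
    rw [Finset.biUnion_insert, Finset.sum_insert ha]
    have h_inter : 0 ≤ ∑ x ∈ u a ∩ s.biUnion u, w x := Finset.sum_nonneg fun x _ => hw x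
    have h_union := Finset.sum_union_inter (s₁ := u a) (s₂ := s.biUnion u) (f := w)
    linarith

/-- The probability of an event under the ER-type model is nonnegative. -/
lemma ERprob_nonneg (n D : ℕ) {p : ℝ} (hp₀ : 0 ≤ p) (hp₁ : p ≤ 1)
    (E : Set (Finset (Fin n → ℕ))) : 0 ≤ ERprob n D p E :=
  Finset.sum_nonneg fun _ _ =>
    mul_nonneg (pow_nonneg hp₀ _) (pow_nonneg (sub_nonneg.2 hp₁) _)

/-- Union bound: an event forcing the random generating set to contain a monomial with property
`P` has probability at most `p` times the number of such monomials. -/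
lemma ERprob_exists_le (n D : ℕ) {p : ℝ} (hp₀ : 0 ≤ p) (hp₁ : p ≤ 1)
    (P : (Fin n → ℕ) → Prop) [DecidablePred P] {E : Set (Finset (Fin n → ℕ))}
    (hE : ∀ B ∈ E, ∃ α ∈ B, P α) :
    ERprob n D p E ≤ ((monSet n D).filter P).card * p := by
  classical
  set w : Finset (Fin n → ℕ) → ℝ := fun B =>
    p ^ B.card * (1 - p) ^ ((monSet n D).card - B.card)
  have w_nonneg : ∀ B, 0 ≤ w B := fun B =>
    mul_nonneg (pow_nonneg hp₀ _) (pow_nonneg (sub_nonneg.2 hp₁) _)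
  calc ERprob n D p E
      ≤ ∑ B ∈ ((monSet n D).filter P).biUnion
          fun α => (monSet n D).powerset.filter (α ∈ ·), w B := by
        refine Finset.sum_le_sum_of_subset_of_nonneg (fun B hB => ?_) fun B _ _ => w_nonneg B
        obtain ⟨hBs, hBE⟩ := Finset.mem_filter.1 hB
        obtain ⟨α, hαB, hα⟩ := hE B hBE
        exact Finset.mem_biUnion.2 ⟨α, Finset.mem_filter.2
          ⟨Finset.mem_powerset.1 hBs hαB, hα⟩, Finset.mem_filter.2 ⟨hBs, hαB⟩⟩
    _ ≤ ∑ α ∈ (monSet n D).filter P, ∑ B ∈ (monSet n D).powerset with α ∈ B, w B :=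
        sum_biUnion_le_sum_sum _ _ w_nonneg
    _ = ∑ α ∈ (monSet n D).filter P, p :=
        Finset.sum_congr rfl fun α hα =>
          sum_powerset_filter_mem_bernoulli _ p (Finset.mem_filter.1 hα).1
    _ = ((monSet n D).filter P).card * p := by simp

/-- There are at most `n.choose t * (D + 1) ^ t` monomials of degree at most `D` supported on
at most `t` variables. -/
lemma card_monSet_filter_support_le (n D : ℕ) {t : ℕ} (ht : t ≤ n) :
    ((monSet n D).filter fun α => (Finset.univ.filter fun i => 0 < α i).card ≤ t).card
      ≤ n.choose t * (D + 1) ^ t := by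
  classical
  let box : Finset (Fin n) → Finset (Fin n → ℕ) := fun S =>
    Fintype.piFinset fun i => if i ∈ S then Finset.range (D + 1) else {0}
  have card_box : ∀ S ∈ Finset.powersetCard t Finset.univ, (box S).card ≤ (D + 1) ^ t := by
    intro S hS
    simp only [box, Fintype.card_piFinset, apply_ite Finset.card, Finset.card_range,
      Finset.card_singleton, Finset.prod_ite_mem, Finset.univ_inter, Finset.prod_const,
      (Finset.mem_powersetCard.1 hS).2, le_refl]
  have h_sub : ((monSet n D).filter fun α => (Finset.univ.filter fun i => 0 < α i).card ≤ t)
      ⊆ (Finset.powersetCard t Finset.univ).biUnion box := by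
    intro α hα
    obtain ⟨hαD, hαt⟩ := Finset.mem_filter.1 hα
    obtain ⟨S, hsupp, hS⟩ := Finset.exists_superset_card_eq hαt (by simpa using ht)
    refine Finset.mem_biUnion.2
      ⟨S, Finset.mem_powersetCard.2 ⟨Finset.subset_univ S, hS⟩, Fintype.mem_piFinset.2 fun i => ?_⟩
    split_ifs with hi
    · exact Fintype.mem_piFinset.1 (Finset.mem_filter.1 hαD).1 i
    · by_contra h
      exact hi (hsupp (by simpa [Nat.pos_iff_ne_zero] using h))
  calc _ ≤ _ := Finset.card_le_card h_sub
    _ ≤ _ := Finset.card_biUnion_le_card_mul _ _ _ card_box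
    _ = n.choose t * (D + 1) ^ t := by simp

/-- Lemma 3.3. For fixed `n` and `0 ≤ t ≤ n-1`, if `p(D) = o(D^{-t})`,
then a.a.s. the random generating set `𝔅` contains no monomial of support size at most `t`
as `D → ∞`; i.e., the probability that `𝔅` contains a monomial whose support has size at
most `t` tends to `0`. -/
theorem stmt7 (n t : ℕ) (hn : 1 ≤ n) (ht : t ≤ n - 1)
    (p : ℕ → ℝ) (hp : ∀ D, 0 < p D ∧ p D < 1)
    (hto : Filter.Tendsto (fun D : ℕ => (D : ℝ) ^ t * p D) Filter.atTop (nhds 0)) :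
    Filter.Tendsto (fun D : ℕ => ERprob n D (p D)
        {B | ∃ α ∈ B, (Finset.univ.filter fun i => 0 < α i).card ≤ t})
      Filter.atTop (nhds 0) := by
  have upper : Tendsto (fun D : ℕ => (n.choose t * 2 ^ t : ℝ) * ((D : ℝ) ^ t * p D))
      atTop (nhds 0) := by
    simpa using hto.const_mul (n.choose t * 2 ^ t : ℝ)
  refine tendsto_of_tendsto_of_tendsto_of_le_of_le' tendsto_const_nhds upper
    (Eventually.of_forall fun D => ERprob_nonneg n D (hp D).1.le (hp D).2.le _) ?_
  filter_upwards [eventually_ge_atTop 1] with D hD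
  refine (ERprob_exists_le n D (hp D).1.le (hp D).2.le _ fun _ hB => hB).trans ?_
  have h_count : (n.choose t * (D + 1) ^ t : ℕ) ≤ n.choose t * 2 ^ t * D ^ t := by
    rw [mul_assoc, ← mul_pow]
    gcongr
    lia
  have h_card := (card_monSet_filter_support_le n D (ht.trans (Nat.sub_le n 1))).trans h_count
  rw [← mul_assoc]
  exact mul_le_mul_of_nonneg_right (mod_cast h_card) (hp D).1.le

end
end
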